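/- Let V be a (G_Γ, β, γ0)-vertex algebra and M a (G_Γ, β, γ0)-left V-module as in the context, and assume β satisfies β(γ1, γ2)·β(γ1, γ3) = β(γ1, γ2+γ3) for all γ1, γ2, γ3 ∈ Γ. Then: (i) Y^M_0(u, Y^M_{−2}(v, w)) ∈ C₂(M) and Y^M_0(Y_{−2}(u, v), w) ∈ C₂(M) for all u, v ∈ V, w ∈ M; (ii) for all γ1, γ2 ∈ Γ, u ∈ V_{γ1}, v ∈ V_{γ2}, w ∈ M: Y^M_0(Y_0(u, v), w) − Y^M_0(u, Y^M_0(v, w)) + β(γ1, γ2)·Y^M_0(v, Y^M_0(u, w)) ∈ C₂(M). Consequently R(M) = M/C₂(M) with the bracket induced by Y^M_0 is a (G_Γ, β)-left Lie module for the (G_Γ, β)-Lie algebra R(V) = V/C₂(V) (bracket induced by Y_0) of degree 0. -/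

import Mathlib

/-- The generalized binomial coefficient `binom(a, i) = a(a-1)⋯(a-i+1)/i!`
for `a : ℤ`, `i : ℕ`; it is an integer. -/
def zbinom (a : ℤ) (i : ℕ) : ℤ :=
  if 0 ≤ a then (a.toNat.choose i : ℤ)
  else (-1 : ℤ) ^ i * ((((i : ℤ) - a - 1).toNat).choose i : ℤ)

/-- A `(G_Γ, β, γ0)`-vertex algebra in component form, *without* the
derivation axiom (which is to be derived): a `Γ`-graded `k`-vector space `V`
(internal direct sum of the subspaces `Vg γ`), bilinear products
`Y n : V → V → V` of degree `n • γ0`, and a vacuum vector `vac ∈ V_0`,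
satisfying truncation, vacuum, creation and the `β`-Jacobi identity. -/
structure PreVA (k : Type*) [Field k] (Γ : Type*) [AddCommGroup Γ] [DecidableEq Γ]
    (γ0 : Γ) (β : Γ → Γ → k)
    (V : Type*) [AddCommGroup V] [Module k V] where
  Vg : Γ → Submodule k V
  internal : DirectSum.IsInternal Vg
  Y : ℤ → V →ₗ[k] V →ₗ[k] V
  vac : V
  vac_mem : vac ∈ Vg 0
  grading : ∀ (n : ℤ) (γ1 γ2 : Γ) (u v : V), u ∈ Vg γ1 → v ∈ Vg γ2 →
      Y n u v ∈ Vg (γ1 + γ2 + n • γ0)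
  truncation : ∀ u v : V, ∃ N : ℤ, ∀ n : ℤ, N ≤ n → Y n u v = 0
  vacuum_left : ∀ v : V, Y (-1) vac v = v
  vacuum_left' : ∀ n : ℤ, n ≠ -1 → ∀ v : V, Y n vac v = 0
  creation : ∀ v : V, Y (-1) v vac = v
  creation' : ∀ n : ℤ, 0 ≤ n → ∀ v : V, Y n v vac = 0
  jacobi : ∀ (l m n : ℤ) (γ1 γ2 : Γ) (u v w : V), u ∈ Vg γ1 → v ∈ Vg γ2 →
      (∑ᶠ i : ℕ, (((-1 : k) ^ i * (zbinom l i : k)) •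
          Y (m + l - (i : ℤ)) u (Y (n + (i : ℤ)) v w)))
        - ((-1 : k) ^ l * β γ1 γ2) •
            (∑ᶠ i : ℕ, (((-1 : k) ^ i * (zbinom l i : k)) •
              Y (n + l - (i : ℤ)) v (Y (m + (i : ℤ)) u w)))
        = ∑ᶠ i : ℕ, ((zbinom m i : k) •
            Y (m + n - (i : ℤ)) (Y (l + (i : ℤ)) u v) w)


/-- A `(G_Γ, β, γ0)`-vertex algebra in component form: a `PreVA` together
with the derivation properties of `D(v) = Y_{-2}(v, 𝟙)`, namely
`D(Y_n(u,v)) - Y_n(u, D v) = -n • Y_{n-1}(u,v)` and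
`Y_n(D u, v) = -n • Y_{n-1}(u,v)`. -/
structure VA (k : Type*) [Field k] (Γ : Type*) [AddCommGroup Γ] [DecidableEq Γ]
    (γ0 : Γ) (β : Γ → Γ → k)
    (V : Type*) [AddCommGroup V] [Module k V]
    extends PreVA k Γ γ0 β V where
  deriv1 : ∀ (n : ℤ) (u v : V),
      Y (-2) (Y n u v) vac - Y n u (Y (-2) v vac) = (-n) • Y (n - 1) u v
  deriv2 : ∀ (n : ℤ) (u v : V),
      Y n (Y (-2) u vac) v = (-n) • Y (n - 1) u v

/-- The subspace `C₂(V) = span_k { Y_{-2}(u, v) : u, v ∈ V }`. -/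
def C2 {k Γ V : Type*} [Field k] [AddCommGroup Γ] [DecidableEq Γ]
    [AddCommGroup V] [Module k V] {γ0 : Γ} {β : Γ → Γ → k}
    (A : VA k Γ γ0 β V) : Submodule k V :=
  Submodule.span k {x : V | ∃ u v : V, A.Y (-2) u v = x}

/-- The data of a `(G_Γ, β, γ0)`-left module over a vertex algebra `A`,
*without* the derivation axiom: a `Γ`-graded `k`-vector space `M` with
bilinear action maps `YM n : V → M → M` of degree `n • γ0`, satisfying the
vacuum, truncation and `β`-Jacobi axioms. -/
structure PreVMod {k Γ V : Type*} [Field k] [AddCommGroup Γ] [DecidableEq Γ]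
    [AddCommGroup V] [Module k V] {γ0 : Γ} {β : Γ → Γ → k}
    (A : VA k Γ γ0 β V)
    (M : Type*) [AddCommGroup M] [Module k M] where
  Mg : Γ → Submodule k M
  internal : DirectSum.IsInternal Mg
  YM : ℤ → V →ₗ[k] M →ₗ[k] M
  grading : ∀ (n : ℤ) (γ δ : Γ) (v : V) (w : M), v ∈ A.Vg γ → w ∈ Mg δ →
      YM n v w ∈ Mg (γ + δ + n • γ0)
  vacuum : ∀ w : M, YM (-1) A.vac w = w
  vacuum' : ∀ n : ℤ, n ≠ -1 → ∀ w : M, YM n A.vac w = 0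
  truncation : ∀ (v : V) (w : M), ∃ N : ℤ, ∀ n : ℤ, N ≤ n → YM n v w = 0
  jacobi : ∀ (l m n : ℤ) (γ1 γ2 : Γ) (u v : V) (w : M),
      u ∈ A.Vg γ1 → v ∈ A.Vg γ2 →
      (∑ᶠ i : ℕ, (((-1 : k) ^ i * (zbinom l i : k)) •
          YM (m + l - (i : ℤ)) u (YM (n + (i : ℤ)) v w)))
        - ((-1 : k) ^ l * β γ1 γ2) •
            (∑ᶠ i : ℕ, (((-1 : k) ^ i * (zbinom l i : k)) •
              YM (n + l - (i : ℤ)) v (YM (m + (i : ℤ)) u w)))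
        = ∑ᶠ i : ℕ, ((zbinom m i : k) •
            YM (m + n - (i : ℤ)) (A.Y (l + (i : ℤ)) u v) w)

/-- A `(G_Γ, β, γ0)`-left module over the vertex algebra `A`: a `PreVMod`
together with the derivation axioms: there is a `k`-linear `D^M : M → M` with
`D^M(Y^M_n(v,w)) - Y^M_n(v, D^M w) = -n • Y^M_{n-1}(v,w)` and
`Y^M_n(D v, w) = -n • Y^M_{n-1}(v,w)` where `D(v) = Y_{-2}(v, 𝟙)`. -/
structure VMod {k Γ V : Type*} [Field k] [AddCommGroup Γ] [DecidableEq Γ]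
    [AddCommGroup V] [Module k V] {γ0 : Γ} {β : Γ → Γ → k}
    (A : VA k Γ γ0 β V)
    (M : Type*) [AddCommGroup M] [Module k M]
    extends PreVMod A M where
  DM : M →ₗ[k] M
  derivM1 : ∀ (n : ℤ) (v : V) (w : M),
      DM (YM n v w) - YM n v (DM w) = (-n) • YM (n - 1) v w
  derivM2 : ∀ (n : ℤ) (v : V) (w : M),
      YM n (A.Y (-2) v A.vac) w = (-n) • YM (n - 1) v w

/-- The subspace `C₂(M) = span_k { Y^M_{-2}(v, w) : v ∈ V, w ∈ M }`. -/
def C2M {k Γ V : Type*} [Field k] [AddCommGroup Γ] [DecidableEq Γ]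
    [AddCommGroup V] [Module k V] {γ0 : Γ} {β : Γ → Γ → k}
    {A : VA k Γ γ0 β V} {M : Type*} [AddCommGroup M] [Module k M]
    (B : VMod A M) : Submodule k M :=
  Submodule.span k {x : M | ∃ (v : V) (w : M), B.YM (-2) v w = x}

theorem aux_zbinom_zero (i : ℕ) (hi : i ≠ 0) : zbinom 0 i = 0 := by
  obtain ⟨j, rfl⟩ := Nat.exists_eq_succ_of_ne_zero hi
  simp [zbinom]

theorem aux_zbinom_zero_zero : zbinom 0 0 = 1 := by
  simp [zbinom]

/-- A vertex algebra as a module over itself. -/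
def auxSelf {k Γ V : Type*} [Field k] [AddCommGroup Γ] [DecidableEq Γ]
    [AddCommGroup V] [Module k V] {γ0 : Γ} {β : Γ → Γ → k}
    (A : VA k Γ γ0 β V) : VMod A V where
  Mg := A.Vg
  internal := A.internal
  YM := A.Y
  grading := A.grading
  vacuum := A.vacuum_left
  vacuum' := A.vacuum_left'
  truncation := A.truncation
  jacobi := A.jacobi
  DM := (A.Y (-2)).flip A.vac
  derivM1 := A.deriv1
  derivM2 := A.deriv2

section aux
variable {k Γ V M : Type*} [Field k] [AddCommGroup Γ]
    [DecidableEq Γ] [AddCommGroup V] [Module k V] [AddCommGroup M] [Module k M]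
    {γ0 : Γ} {β : Γ → Γ → k} {A : VA k Γ γ0 β V} (B : VMod A M)

theorem aux_comm (n : ℤ) (γ1 γ2 : Γ) (u v : V) (w : M)
    (hu : u ∈ A.Vg γ1) (hv : v ∈ A.Vg γ2) :
    B.YM 0 u (B.YM n v w) - β γ1 γ2 • B.YM n v (B.YM 0 u w)
      = B.YM n (A.Y 0 u v) w := by
  have h := B.jacobi 0 0 n γ1 γ2 u v w hu hv
  rw [finsum_eq_single _ 0 (fun i hi => by simp [aux_zbinom_zero i hi]),
    finsum_eq_single _ 0 (fun i hi => by simp [aux_zbinom_zero i hi]),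
    finsum_eq_single _ 0 (fun i hi => by simp [aux_zbinom_zero i hi])] at h
  simpa [aux_zbinom_zero_zero] using h

theorem aux_neg_mem [CharZero k] (i : ℕ) : ∀ (u : V) (w : M),
    B.YM (-2 - (i : ℤ)) u w ∈ C2M B := by
  induction i with
  | zero => intro u w; exact Submodule.subset_span ⟨u, w, by simp⟩
  | succ i ih =>
    intro u w
    have h := B.derivM2 (-2 - (i : ℤ)) u w
    have h2 := ih (A.Y (-2) u A.vac) w
    rw [h, ← Int.cast_smul_eq_zsmul k] at h2
    have hne : ((-(-2 - (i : ℤ)) : ℤ) : k) ≠ 0 := by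
      rw [Int.cast_ne_zero]; omega
    have h3 := (Submodule.smul_mem_iff _ hne).1 h2
    have e : (-2 - ((i + 1 : ℕ) : ℤ)) = -2 - (i : ℤ) - 1 := by push_cast; ring
    rw [e]; exact h3

theorem aux_homog (P : V → Prop) (h0 : P 0) (hadd : ∀ x y, P x → P y → P (x + y))
    (h : ∀ γ, ∀ u ∈ A.Vg γ, P u) (u : V) : P u := by
  have hu : u ∈ ⨆ γ, A.Vg γ := by
    rw [A.internal.submodule_iSup_eq_top]; trivial
  exact Submodule.iSup_induction A.Vg (motive := P) hu h h0 hadd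

theorem aux_i1 (u v : V) (w : M) : B.YM 0 u (B.YM (-2) v w) ∈ C2M B := by
  induction u using aux_homog (A := A) with
  | h0 => simp
  | hadd x y hx hy => simpa using add_mem hx hy
  | h γ1 u hu =>
    induction v using aux_homog (A := A) with
    | h0 => simp
    | hadd x y hx hy => simpa using add_mem hx hy
    | h γ2 v hv =>
      rw [sub_eq_iff_eq_add.1 (aux_comm B (-2) γ1 γ2 u v w hu hv)]
      exact add_mem (Submodule.subset_span ⟨_, _, rfl⟩)
        (Submodule.smul_mem _ _ (Submodule.subset_span ⟨_, _, rfl⟩))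

theorem aux_i2 [CharZero k] (u v : V) (w : M) :
    B.YM 0 (A.Y (-2) u v) w ∈ C2M B := by
  induction u using aux_homog (A := A) with
  | h0 => simp
  | hadd x y hx hy => simpa using add_mem hx hy
  | h γ1 u hu =>
    induction v using aux_homog (A := A) with
    | h0 => simp
    | hadd x y hx hy => simpa using add_mem hx hy
    | h γ2 v hv =>
      have h := B.jacobi (-2) 0 0 γ1 γ2 u v w hu hv
      rw [finsum_eq_single (fun i : ℕ => ((zbinom 0 i : k) •
            B.YM (0 + 0 - (i : ℤ)) (A.Y (-2 + (i : ℤ)) u v) w)) 0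
            (fun i hi => by simp [aux_zbinom_zero i hi])] at h
      have e : B.YM 0 (A.Y (-2) u v) w = ((zbinom 0 0 : ℤ) : k) •
          B.YM (0 + 0 - ((0 : ℕ) : ℤ)) (A.Y (-2 + ((0 : ℕ) : ℤ)) u v) w := by
        simp [aux_zbinom_zero_zero]
      rw [e, ← h]
      refine sub_mem ?_ (Submodule.smul_mem _ _ ?_)
      · refine finsum_induction (· ∈ C2M B) (zero_mem _) (fun _ _ => add_mem) (fun i => ?_)
        refine Submodule.smul_mem _ _ ?_
        rw [zero_add (-2 : ℤ)]
        exact aux_neg_mem B i _ _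
      · refine finsum_induction (· ∈ C2M B) (zero_mem _) (fun _ _ => add_mem) (fun i => ?_)
        refine Submodule.smul_mem _ _ ?_
        rw [zero_add (-2 : ℤ)]
        exact aux_neg_mem B i _ _

theorem aux_desc [CharZero k] : ∃ f : (V ⧸ C2 A) → (M ⧸ C2M B) → (M ⧸ C2M B),
    ∀ (v : V) (w : M), f (Submodule.Quotient.mk v) (Submodule.Quotient.mk w)
          = Submodule.Quotient.mk (B.YM 0 v w) := by
  have h1 : ∀ v ∈ C2 A, ∀ w : M, B.YM 0 v w ∈ C2M B := by
    intro v hv w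
    have : C2 A ≤ (C2M B).comap ((B.YM 0).flip w) := by
      refine Submodule.span_le.2 ?_
      rintro _ ⟨u, v, rfl⟩
      exact aux_i2 B u v w
    exact this hv
  have h2 : ∀ v : V, ∀ w ∈ C2M B, B.YM 0 v w ∈ C2M B := by
    intro v w hw
    have : C2M B ≤ (C2M B).comap (B.YM 0 v) := by
      refine Submodule.span_le.2 ?_
      rintro _ ⟨u, w, rfl⟩
      exact aux_i1 B v u w
    exact this hw
  refine ⟨fun x y => Submodule.Quotient.mk (B.YM 0 x.out y.out), fun v w => ?_⟩
  rw [Submodule.Quotient.eq]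
  set v' := (Submodule.Quotient.mk v : V ⧸ C2 A).out with hv'
  set w' := (Submodule.Quotient.mk w : M ⧸ C2M B).out with hw'
  have a : v' - v ∈ C2 A := by
    rw [← Submodule.Quotient.eq]; exact Quotient.out_eq _
  have b : w' - w ∈ C2M B := by
    rw [← Submodule.Quotient.eq]; exact Quotient.out_eq _
  have : B.YM 0 v' w' - B.YM 0 v w = B.YM 0 (v' - v) w' + B.YM 0 v (w' - w) := by
    simp
  rw [this]
  exact add_mem (h1 _ a _) (h2 _ _ b)

end aux

/-- for a `(G_Γ, β, γ0)`-vertex algebra `V` and a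
`(G_Γ, β, γ0)`-left `V`-module `M`, assuming
`β(γ1,γ2)·β(γ1,γ3) = β(γ1,γ2+γ3)`:
(i) `Y^M_0(u, Y^M_{-2}(v,w)) ∈ C₂(M)` and `Y^M_0(Y_{-2}(u,v), w) ∈ C₂(M)`;
(ii) `Y^M_0(Y_0(u,v), w) - Y^M_0(u, Y^M_0(v,w))
       + β(γ1,γ2) • Y^M_0(v, Y^M_0(u,w)) ∈ C₂(M)` for homogeneous `u, v`.
Consequently `R(M) = M/C₂(M)` with the bracket induced by `Y^M_0` is a
`(G_Γ, β)`-left Lie module for the `(G_Γ, β)`-Lie algebra `R(V) = V/C₂(V)`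
(bracket induced by `Y_0`) of degree `0`. -/
theorem statement15 {k Γ V M : Type*} [Field k] [CharZero k] [AddCommGroup Γ]
    [DecidableEq Γ] [AddCommGroup V] [Module k V] [AddCommGroup M] [Module k M]
    (γ0 : Γ) (β : Γ → Γ → k) (A : VA k Γ γ0 β V) (B : VMod A M)
    (hβmul : ∀ γ1 γ2 γ3 : Γ, β γ1 γ2 * β γ1 γ3 = β γ1 (γ2 + γ3)) :
    (∀ (u v : V) (w : M), B.YM 0 u (B.YM (-2) v w) ∈ C2M B) ∧
    (∀ (u v : V) (w : M), B.YM 0 (A.Y (-2) u v) w ∈ C2M B) ∧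
    (∀ (γ1 γ2 : Γ) (u v : V) (w : M), u ∈ A.Vg γ1 → v ∈ A.Vg γ2 →
      B.YM 0 (A.Y 0 u v) w - B.YM 0 u (B.YM 0 v w)
        + β γ1 γ2 • B.YM 0 v (B.YM 0 u w) ∈ C2M B) ∧
    (∃ (π0 : (V ⧸ C2 A) → (V ⧸ C2 A) → (V ⧸ C2 A))
       (π0M : (V ⧸ C2 A) → (M ⧸ C2M B) → (M ⧸ C2M B)),
      (∀ u v : V, π0 (Submodule.Quotient.mk u) (Submodule.Quotient.mk v)
          = Submodule.Quotient.mk (A.Y 0 u v)) ∧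
      (∀ (v : V) (w : M),
        π0M (Submodule.Quotient.mk v) (Submodule.Quotient.mk w)
          = Submodule.Quotient.mk (B.YM 0 v w)) ∧
      (∀ (γ1 γ2 : Γ) (u v : V), u ∈ A.Vg γ1 → v ∈ A.Vg γ2 →
        ∀ m : M ⧸ C2M B,
        π0M (π0 (Submodule.Quotient.mk u) (Submodule.Quotient.mk v)) m
          = π0M (Submodule.Quotient.mk u) (π0M (Submodule.Quotient.mk v) m)
            - β γ1 γ2 •
                π0M (Submodule.Quotient.mk v)
                  (π0M (Submodule.Quotient.mk u) m))) := by
  have hii : ∀ (γ1 γ2 : Γ) (u v : V) (w : M), u ∈ A.Vg γ1 → v ∈ A.Vg γ2 →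
      B.YM 0 (A.Y 0 u v) w
        = B.YM 0 u (B.YM 0 v w) - β γ1 γ2 • B.YM 0 v (B.YM 0 u w) :=
    fun γ1 γ2 u v w hu hv => (aux_comm B 0 γ1 γ2 u v w hu hv).symm
  refine ⟨aux_i1 B, aux_i2 B, ?_, ?_⟩
  · intro γ1 γ2 u v w hu hv
    rw [hii γ1 γ2 u v w hu hv]
    simp
  · have hex : ∃ f : (V ⧸ C2 A) → (V ⧸ C2 A) → (V ⧸ C2 A), ∀ u v : V,
        f (Submodule.Quotient.mk u) (Submodule.Quotient.mk v)
          = Submodule.Quotient.mk (A.Y 0 u v) := aux_desc (auxSelf A)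
    obtain ⟨f, hf⟩ := hex
    obtain ⟨g, hg⟩ := aux_desc B
    refine ⟨f, g, hf, hg, ?_⟩
    intro γ1 γ2 u v hu hv m
    obtain ⟨w, rfl⟩ := Submodule.Quotient.mk_surjective _ m
    simp only [hf, hg]
    rw [hii γ1 γ2 u v w hu hv]
    rfl
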